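/- arXiv:1912.09467 — 4 statements merged into one kernel-verified Lean document; each statement's English description precedes it below -/
import Mathlib

section
/- Let d ≥ 2 be a natural number and μ, r real numbers with r > 0. If either (i) 0 < μ < 1/d and r ≤ 2d(d−2)μ/((d+1)(4⌈d/2⌉ − d)), in which case set δ^ach = (1 − dμ)/r + 2(d+1)⌈d/2⌉/d, or (ii) 1/d ≤ μ < 1/2 and r ≤ 2d(1 − 2μ)/((d+1)(4⌈d/2⌉ − d)), in which case set δ^ach = 2(d+1)⌈d/2⌉/d, then δ^full := (1 − 2μ)/r + (d+1)/2 satisfies δ^full ≥ δ^ach. Here ⌈d/2⌉ denotes the ceiling of d/2 computed in the natural numbers. -/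
/-- A fronthaul capacity bound `r ≤ 2dN / ((d+1)(4c − d))` makes the delivery-time saving
`N / r` outweigh the gap between `2(d+1)c/d` and `(d+1)/2`. -/
lemma le_div_add_of_le_threshold {d c N r : ℝ} (hd : 0 < d) (hc : d < 4 * c) (hr : 0 < r)
    (h : r ≤ 2 * d * N / ((d + 1) * (4 * c - d))) :
    2 * (d + 1) * c / d ≤ N / r + (d + 1) / 2 := by
  have hD : 0 < (d + 1) * (4 * c - d) := mul_pos (by linarith) (by linarith)
  rw [le_div_iff₀ hD] at h
  have hN : (d + 1) * (4 * c - d) / (2 * d) ≤ N / r := by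
    rw [div_le_div_iff₀ (by positivity) hr]
    linarith
  have hsplit : 2 * (d + 1) * c / d = (d + 1) * (4 * c - d) / (2 * d) + (d + 1) / 2 := by
    field_simp
    ring
  linarith


/-- Proposition 2 of the paper: in either fronthaul regime (low cache `0 < μ < 1/d` with
`r ≤ r₁`, or medium cache `1/d ≤ μ < 1/2` with `r ≤ r₂`), the NDT of the full-caching
benchmark `δ^full = (1 − 2μ)/r + (d+1)/2` is at least the NDT `δ^ach` of the proposed
scheme, with `⌈d/2⌉ = (d + 1) / 2` computed in `ℕ`. -/
theorem stmt3 (d : ℕ) (hd : 2 ≤ d) (μ r δach : ℝ) (hr : 0 < r)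
    (h : (0 < μ ∧ μ < 1 / d ∧
            r ≤ 2 * d * ((d : ℝ) - 2) * μ /
                (((d : ℝ) + 1) * (4 * (((d + 1) / 2 : ℕ) : ℝ) - d)) ∧
            δach = (1 - d * μ) / r + 2 * ((d : ℝ) + 1) * (((d + 1) / 2 : ℕ) : ℝ) / d) ∨
        (1 / d ≤ μ ∧ μ < 1 / 2 ∧
            r ≤ 2 * d * (1 - 2 * μ) /
                (((d : ℝ) + 1) * (4 * (((d + 1) / 2 : ℕ) : ℝ) - d)) ∧
            δach = 2 * ((d : ℝ) + 1) * (((d + 1) / 2 : ℕ) : ℝ) / d)) :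
    (1 - 2 * μ) / r + ((d : ℝ) + 1) / 2 ≥ δach := by
  have hd0 : (0 : ℝ) < d := by exact_mod_cast (by omega : 0 < d)
  have hc : (d : ℝ) < 4 * (((d + 1) / 2 : ℕ) : ℝ) := by
    exact_mod_cast (by omega : d < 4 * ((d + 1) / 2))
  rcases h with ⟨-, -, hle, rfl⟩ | ⟨-, -, hle, rfl⟩
  · rw [mul_assoc (2 * (d : ℝ))] at hle
    have key := le_div_add_of_le_threshold hd0 hc hr hle
    have hsplit : (1 - 2 * μ) / r = (1 - d * μ) / r + ((d : ℝ) - 2) * μ / r := by ring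
    linarith
  · exact le_div_add_of_le_threshold hd0 hc hr hle
end

section
/- Let d ≥ 2 and s be natural numbers with 1 ≤ s ≤ d, and let i be an integer. Let A := {i + b(d+1) : b ∈ ℤ} ∪ {i + s + b(d+1) : b ∈ ℤ} ⊆ ℤ be the set of scheduled EN indices in one time slot. For an integer u, let T_u := Finset.Icc (u − d + 1) u ⊆ ℤ be the set of ENs connected to user u. Then for every integer b, the intended type-s user u = i + s − 1 + b(d+1) satisfies T_u ∩ A = {i + b(d+1)}: among all scheduled ENs, the only one connected to u is its serving EN. -/
/-- A multiple `k * n` strictly between `-n` and `n` has `k = 0`. -/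
theorem Int.eq_zero_of_neg_lt_mul_of_mul_lt {k n : ℤ} (h₁ : -n < k * n) (h₂ : k * n < n) :
    k = 0 := by
  have hn : 0 < n := by linarith
  have hlow : -1 < k := lt_of_mul_lt_mul_right (by linarith) hn.le
  have hupp : k < 1 := lt_of_mul_lt_mul_right (by linarith) hn.le
  omega

/-- Interference-freeness for the type-`s` intended users (integer-line model): with
scheduled ENs `A = {i + b(d+1)} ∪ {i + s + b(d+1)}` and `T_u = Icc (u − d + 1) u`,
for every block `b` the user `u = i + s − 1 + b(d+1)` satisfies
`T_u ∩ A = {i + b(d+1)}`. -/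
theorem stmt6 (d s : ℕ) (hd : 2 ≤ d) (hs1 : 1 ≤ s) (hs2 : s ≤ d) (i : ℤ) :
    ∀ b : ℤ,
      (↑(Finset.Icc (i + s - 1 + b * (d + 1) - d + 1) (i + s - 1 + b * (d + 1))) : Set ℤ)
          ∩ ({x : ℤ | ∃ c : ℤ, x = i + c * (d + 1)} ∪
             {x : ℤ | ∃ c : ℤ, x = i + s + c * (d + 1)})
        = {i + b * (d + 1)} := by
  intro b
  ext x
  simp only [Finset.coe_Icc, Set.mem_inter_iff, Set.mem_Icc, Set.mem_union, Set.mem_ofPred_eq,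
    Set.mem_singleton_iff]
  constructor
  · rintro ⟨⟨hl, hu⟩, ⟨c, rfl⟩ | ⟨c, rfl⟩⟩
    · have hc : c - b = 0 :=
        Int.eq_zero_of_neg_lt_mul_of_mul_lt (n := d + 1) (by rw [sub_mul]; omega)
          (by rw [sub_mul]; omega)
      rw [sub_eq_zero.mp hc]
    · have hc : c - b = 0 :=
        Int.eq_zero_of_neg_lt_mul_of_mul_lt (n := d + 1) (by rw [sub_mul]; linarith)
          (by rw [sub_mul]; linarith)
      rw [sub_eq_zero.mp hc] at hu
      linarith
  · rintro rfl
    exact ⟨⟨by omega, by omega⟩, Or.inl ⟨b, rfl⟩⟩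
end

section
/- Let d ≥ 2 and s be natural numbers with 1 ≤ s ≤ d, and let i be an integer. Let A := {i + b(d+1) : b ∈ ℤ} ∪ {i + s + b(d+1) : b ∈ ℤ} ⊆ ℤ be the set of scheduled EN indices in one time slot. For an integer u, let T_u := Finset.Icc (u − d + 1) u ⊆ ℤ be the set of ENs connected to user u. Then for every integer b, the intended type-(d−s+1) user u = i + d + b(d+1) satisfies T_u ∩ A = {i + s + b(d+1)}: among all scheduled ENs, the only one connected to u is its serving EN. -/
/-- A multiple of `d + 1` separating two integers of `[0, d]` is zero. -/
theorem eq_zero_of_add_mul_mem_Icc {d r k : ℤ} (hr0 : 0 ≤ r) (hrd : r ≤ d)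
    (h0 : 0 ≤ r + k * (d + 1)) (hd : r + k * (d + 1) ≤ d) : k = 0 := by
  have h1 : -1 < k := by
    by_contra! h
    nlinarith
  have h2 : k < 1 := by
    by_contra! h
    nlinarith
  omega

/-- Interference-freeness for the type-`(d−s+1)` intended users (integer-line model): with
scheduled ENs `A = {i + b(d+1)} ∪ {i + s + b(d+1)}` and `T_u = Icc (u − d + 1) u`,
for every block `b` the user `u = i + d + b(d+1)` satisfies
`T_u ∩ A = {i + s + b(d+1)}`. -/
theorem stmt7 (d s : ℕ) (hd : 2 ≤ d) (hs1 : 1 ≤ s) (hs2 : s ≤ d) (i : ℤ) :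
    ∀ b : ℤ,
      (↑(Finset.Icc (i + d + b * (d + 1) - d + 1) (i + d + b * (d + 1))) : Set ℤ)
          ∩ ({x : ℤ | ∃ c : ℤ, x = i + c * (d + 1)} ∪
             {x : ℤ | ∃ c : ℤ, x = i + s + c * (d + 1)})
        = {i + s + b * (d + 1)} := by
  intro b
  ext x
  simp only [Finset.coe_Icc, Set.mem_inter_iff, Set.mem_Icc, Set.mem_union, Set.mem_ofPred_eq,
    Set.mem_singleton_iff]
  constructor
  · rintro ⟨⟨hl, hu⟩, ⟨c, rfl⟩ | ⟨c, rfl⟩⟩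
    · have hcb : c - b = 0 := eq_zero_of_add_mul_mem_Icc (d := d) (r := 0) le_rfl
        (by positivity) (by linarith) (by linarith)
      obtain rfl : c = b := by linarith
      linarith
    · have hcb : c - b = 0 := eq_zero_of_add_mul_mem_Icc (d := d) (r := s) (by positivity)
        (by exact_mod_cast hs2) (by linarith) (by linarith)
      obtain rfl : c = b := by linarith
      rfl
  · rintro rfl
    exact ⟨⟨by linarith [(Nat.one_le_cast (α := ℤ)).2 hs1],
      by linarith [(Nat.cast_le (α := ℤ)).2 hs2]⟩, Or.inr ⟨b, rfl⟩⟩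
end

section
/- Let d ≥ 2 and s be natural numbers with 1 ≤ s ≤ d, let m ≥ 2 be a natural number, and set K := m(d+1). Work in ZMod K with an arbitrary element i. Let A := { i + b·(d+1) : b ∈ Finset.range m } ∪ { i + s + b·(d+1) : b ∈ Finset.range m } ⊆ ZMod K, and for u ∈ ZMod K let T_u := { u − k : k ∈ Finset.range d } be the set of ENs connected to user u. Then for every b ∈ Finset.range m, T_{i + s − 1 + b(d+1)} ∩ A = { i + b(d+1) } and T_{i + d + b(d+1)} ∩ A = { i + s + b(d+1) }. -/
/-- An integer of absolute value less than `n` whose residue modulo a multiple of `n` is a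
multiple of `n` vanishes. -/
theorem ZMod.int_eq_zero_of_cast_eq_mul {K n : ℕ} (hn : n ∣ K) {x y : ℤ}
    (h : (x : ZMod K) = y * n) (hx : |x| < n) : x = 0 := by
  have hK : ((x - y * n : ℤ) : ZMod K) = 0 := by
    push_cast
    rw [h, sub_self]
  have hdvd : (n : ℤ) ∣ x - y * n :=
    (Int.natCast_dvd_natCast.2 hn).trans ((ZMod.intCast_zmod_eq_zero_iff_dvd _ _).1 hK)
  exact Int.eq_zero_of_abs_lt_dvd ((dvd_sub_left (dvd_mul_left _ _)).1 hdvd) hx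

/-- Cyclic interference-freeness of the scheme: in `ZMod K` with `K = m(d+1)`, `m ≥ 2`,
scheduled ENs `A = {i + b(d+1) : b < m} ∪ {i + s + b(d+1) : b < m}` and
`T_u = {u − k : k < d}`, each intended user hears exactly its serving EN:
`T_{i+s−1+b(d+1)} ∩ A = {i + b(d+1)}` and `T_{i+d+b(d+1)} ∩ A = {i + s + b(d+1)}`. -/
theorem stmt8 (d s m K : ℕ) (hd : 2 ≤ d) (hs1 : 1 ≤ s) (hs2 : s ≤ d) (hm : 2 ≤ m)
    (hK : K = m * (d + 1)) (i : ZMod K) :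
    ∀ b ∈ Finset.range m,
      ((Finset.range d).image (fun k : ℕ => i + (s : ZMod K) - 1 + (b : ZMod K) * (d + 1) - k)
          ∩ ((Finset.range m).image (fun c : ℕ => i + (c : ZMod K) * (d + 1)) ∪
             (Finset.range m).image (fun c : ℕ => i + (s : ZMod K) + (c : ZMod K) * (d + 1)))
        = {i + (b : ZMod K) * (d + 1)}) ∧
      ((Finset.range d).image (fun k : ℕ => i + (d : ZMod K) + (b : ZMod K) * (d + 1) - k)
          ∩ ((Finset.range m).image (fun c : ℕ => i + (c : ZMod K) * (d + 1)) ∪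
             (Finset.range m).image (fun c : ℕ => i + (s : ZMod K) + (c : ZMod K) * (d + 1)))
        = {i + (s : ZMod K) + (b : ZMod K) * (d + 1)}) := by
  intro b hb
  have hdvd : d + 1 ∣ K := hK ▸ dvd_mul_left _ _
  constructor <;> ext x <;>
    simp only [Finset.mem_inter, Finset.mem_union, Finset.mem_image, Finset.mem_singleton,
      Finset.mem_range] at hb ⊢ <;> constructor
  · rintro ⟨⟨k, hk, rfl⟩, ⟨c, -, hc⟩ | ⟨c, -, hc⟩⟩
    · have hx := ZMod.int_eq_zero_of_cast_eq_mul hdvd (x := (s : ℤ) - 1 - k) (y := (c : ℤ) - b)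
        (by push_cast; linear_combination -hc) (by rw [abs_lt]; omega)
      have hs : s = k + 1 := by omega
      subst hs
      push_cast
      ring
    · have hx := ZMod.int_eq_zero_of_cast_eq_mul hdvd (x := -1 - (k : ℤ)) (y := (c : ℤ) - b)
        (by push_cast; linear_combination -hc) (by rw [abs_lt]; omega)
      omega
  · rintro rfl
    refine ⟨⟨s - 1, by omega, ?_⟩, Or.inl ⟨b, hb, rfl⟩⟩
    push_cast [Nat.cast_sub hs1]
    ring
  · rintro ⟨⟨k, hk, rfl⟩, ⟨c, -, hc⟩ | ⟨c, -, hc⟩⟩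
    · have hx := ZMod.int_eq_zero_of_cast_eq_mul hdvd (x := (d : ℤ) - k) (y := (c : ℤ) - b)
        (by push_cast; linear_combination -hc) (by rw [abs_lt]; omega)
      omega
    · have hx := ZMod.int_eq_zero_of_cast_eq_mul hdvd (x := (d : ℤ) - s - k) (y := (c : ℤ) - b)
        (by push_cast; linear_combination -hc) (by rw [abs_lt]; omega)
      have hds : d = s + k := by omega
      subst hds
      push_cast
      ring
  · rintro rfl
    refine ⟨⟨d - s, by omega, ?_⟩, Or.inr ⟨b, hb, rfl⟩⟩
    push_cast [Nat.cast_sub hs2]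
    ring
end
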